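/- arXiv:2605.31036 — 2 statements merged into one kernel-verified Lean document; each statement's English description precedes it below -/
import Mathlib

section
/- Consider MAX-CPA bidders without budget constraints under the VCG mechanism, where bidder i has per-conversion value v_i > 0, truthful bidding is dominant, and the welfare of a model with partition P is Welfare(P) = Σ_{C ∈ P} w_C · max_i (v_i · p_{i,C}). If partition P_A refines partition P_B, then Welfare(P_A) ≥ Welfare(P_B). -/
/-!
STATEMENT 3: VCG welfare monotonicity for MAX-CPA bidders.
MAX-CPA bidders without budgets have per-conversion values `v_i > 0`; under VCG each
cluster is allocated to the bidder maximizing `v_i · p_{i,C}`, so the welfare of a model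
with partition `P` is `Welfare(P) = Σ_{C ∈ P} w_C · max_i (v_i · p_{i,C})`.
If `P_A` refines `P_B`, then `Welfare(P_A) ≥ Welfare(P_B)`.
-/

/-- `P` is a partition of the finite set `U` into nonempty, pairwise disjoint clusters. -/
def IsPartition {α : Type*} [DecidableEq α] (U : Finset α) (P : Finset (Finset α)) : Prop :=
  (∀ C ∈ P, C.Nonempty) ∧
  (∀ C ∈ P, ∀ D ∈ P, C ≠ D → Disjoint C D) ∧
  P.biUnion id = U

/-- The weight of cluster `C`: `w_C = |C| / |U|`. -/
noncomputable def weight {α : Type*} (U C : Finset α) : ℝ :=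
  (C.card : ℝ) / (U.card : ℝ)

/-- The predicted conversion probability on cluster `C`. -/
noncomputable def clusterPred {α : Type*} (p : α → ℝ) (C : Finset α) : ℝ :=
  (∑ u ∈ C, p u) / (C.card : ℝ)

/-- `P_A` refines `P_B`: every cluster of `P_A` is contained in some cluster of `P_B`. -/
def Refines {α : Type*} (PA PB : Finset (Finset α)) : Prop :=
  ∀ C ∈ PA, ∃ D ∈ PB, C ⊆ D

/-- VCG welfare: `Welfare(P) = Σ_{C ∈ P} w_C · max_i (v_i · p_{i,C})`. -/
noncomputable def vcgWelfare {α ι : Type*} [Fintype ι] [Nonempty ι]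
    (U : Finset α) (P : Finset (Finset α)) (v : ι → ℝ) (p : ι → α → ℝ) : ℝ :=
  ∑ C ∈ P, weight U C *
    (Finset.univ.sup' Finset.univ_nonempty fun i => v i * clusterPred (p i) C)

/-- The clusters of a finer partition inside a coarser cluster `D` cover `D`. -/
theorem IsPartition.biUnion_filter_subset {α : Type*} [DecidableEq α] {U : Finset α}
    {PA PB : Finset (Finset α)} (hPA : IsPartition U PA) (hPB : IsPartition U PB)
    (href : Refines PA PB) {D : Finset α} (hD : D ∈ PB) :
    (PA.filter (· ⊆ D)).biUnion id = D := by
  ext u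
  simp only [Finset.mem_biUnion, Finset.mem_filter, id]
  constructor
  · rintro ⟨C, ⟨-, hCD⟩, hu⟩
    exact hCD hu
  · intro hu
    have huU : u ∈ PA.biUnion id := by
      rw [hPA.2.2, ← hPB.2.2]
      exact Finset.mem_biUnion.2 ⟨D, hD, hu⟩
    obtain ⟨C, hC, huC⟩ := Finset.mem_biUnion.1 huU
    obtain ⟨E, hE, hCE⟩ := href C hC
    obtain rfl : E = D := by
      by_contra hne
      exact Finset.disjoint_left.1 (hPB.2.1 E hE D hD hne) (hCE huC) hu
    exact ⟨C, ⟨hC, hCE⟩, huC⟩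

/-- Summing over a finer partition amounts to summing over the clusters inside each coarser one. -/
theorem IsPartition.sum_filter_subset {α : Type*} [DecidableEq α] {U : Finset α}
    {PA PB : Finset (Finset α)} (hPA : IsPartition U PA) (hPB : IsPartition U PB)
    (href : Refines PA PB) (f : Finset α → ℝ) :
    ∑ D ∈ PB, ∑ C ∈ PA.filter (· ⊆ D), f C = ∑ C ∈ PA, f C := by
  rw [← Finset.sum_biUnion]
  · congr 1
    ext C
    simp only [Finset.mem_biUnion, Finset.mem_filter]
    constructor
    · rintro ⟨-, -, hC, -⟩
      exact hC
    · intro hC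
      obtain ⟨D, hD, hCD⟩ := href C hC
      exact ⟨D, hD, hC, hCD⟩
  · intro D hD E hE hne
    refine Finset.disjoint_left.2 fun C hCD hCE => ?_
    rw [Finset.mem_filter] at hCD hCE
    obtain ⟨u, hu⟩ := hPA.1 C hCD.1
    exact Finset.disjoint_left.1 (hPB.2.1 D hD E hE hne) (hCD.2 hu) (hCE.2 hu)

theorem weight_mul_mul_clusterPred {α : Type*} (U C : Finset α) (a : ℝ) (q : α → ℝ) :
    weight U C * (a * clusterPred q C) = ∑ u ∈ C, a * q u / (U.card : ℝ) := by
  rcases C.eq_empty_or_nonempty with rfl | hC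
  · simp [weight]
  · have : (C.card : ℝ) ≠ 0 := by exact_mod_cast hC.card_ne_zero
    rw [weight, clusterPred, ← Finset.sum_div, ← Finset.mul_sum]
    field_simp

theorem vcg_welfare_monotone {α ι : Type*} [DecidableEq α] [Fintype ι] [Nonempty ι]
    (U : Finset α) (hU : U.Nonempty)
    (PA PB : Finset (Finset α)) (hPA : IsPartition U PA) (hPB : IsPartition U PB)
    (href : Refines PA PB)
    (v : ι → ℝ) (hv : ∀ i, 0 < v i)
    (p : ι → α → ℝ) (hp : ∀ i u, p i u ∈ Set.Icc (0 : ℝ) 1) :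
    vcgWelfare U PB v p ≤ vcgWelfare U PA v p := by
  unfold vcgWelfare
  rw [← hPA.sum_filter_subset hPB href]
  refine Finset.sum_le_sum fun D hD => ?_
  obtain ⟨i, -, hi⟩ := Finset.exists_mem_eq_sup' Finset.univ_nonempty
    fun i => v i * clusterPred (p i) D
  have hdisj : (↑(PA.filter (· ⊆ D)) : Set (Finset α)).PairwiseDisjoint id := by
    intro C hC E hE hne
    exact hPA.2.1 C (Finset.mem_filter.1 hC).1 E (Finset.mem_filter.1 hE).1 hne
  calc weight U D * (Finset.univ.sup' Finset.univ_nonempty fun i => v i * clusterPred (p i) D)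
      = ∑ u ∈ D, v i * p i u / (U.card : ℝ) := by rw [hi, weight_mul_mul_clusterPred]
    _ = ∑ C ∈ PA.filter (· ⊆ D), ∑ u ∈ C, v i * p i u / (U.card : ℝ) := by
      conv_lhs => rw [← hPA.biUnion_filter_subset hPB href hD]
      exact Finset.sum_biUnion hdisj
    _ ≤ _ := by
      refine Finset.sum_le_sum fun C _ => ?_
      rw [← weight_mul_mul_clusterPred]
      exact mul_le_mul_of_nonneg_left
        (Finset.le_sup' (fun i => v i * clusterPred (p i) C) (Finset.mem_univ i))
        (div_nonneg (Nat.cast_nonneg _) (Nat.cast_nonneg _))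
end

section
/- Consider the allocation linear program over a partition P: maximize Σ_i Σ_{C ∈ P} w_C · x_{i,C} · a_i · p_{i,C} over x_{i,C} ∈ [0,1] subject to the budget constraints Σ_{C ∈ P} w_C · x_{i,C} · a_i · p_{i,C} ≤ B_i for each i and the supply constraints Σ_i x_{i,C} ≤ 1 for each C, where a_i ≥ 0 are bidder-specific constants and B_i ≥ 0 are budgets. Suppose P_A refines P_B and x^B is a feasible solution for the LP over P_B. Define the lifted solution x^A by x^A_{i,C'} = x^B_{i,C} for every refined cluster C' ∈ P_A contained in C ∈ P_B. Then x^A is feasible for the LP over P_A, for every bidder i the budget usage satisfies Σ_{C' ∈ P_A} w_{C'} · x^A_{i,C'} · a_i · p_{i,C'} = Σ_{C ∈ P_B} w_C · x^B_{i,C} · a_i · p_{i,C}, and the objective values of x^A and x^B are equal. -/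
theorem weight_mul_clusterPred {α : Type*} (U C : Finset α) (p : α → ℝ) :
    weight U C * clusterPred p C = (∑ u ∈ C, p u) / (U.card : ℝ) := by
  unfold weight clusterPred
  rcases C.eq_empty_or_nonempty with rfl | hC
  · simp
  · have : (C.card : ℝ) ≠ 0 := by exact_mod_cast hC.card_pos.ne'
    field_simp

/-- The clusters of a refinement that lie over a coarse cluster `C` cover `C` exactly. -/
theorem IsPartition.biUnion_filter_eq {α : Type*} [DecidableEq α] {U : Finset α}
    {PA PB : Finset (Finset α)} (hPA : IsPartition U PA) (hPB : IsPartition U PB)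
    {f : Finset α → Finset α} (hf : ∀ C' ∈ PA, f C' ∈ PB ∧ C' ⊆ f C')
    {C : Finset α} (hC : C ∈ PB) :
    (PA.filter (fun C' => f C' = C)).biUnion id = C := by
  ext u
  simp only [Finset.mem_biUnion, Finset.mem_filter, id]
  constructor
  · rintro ⟨C', ⟨hC', rfl⟩, hu⟩
    exact (hf C' hC').2 hu
  · intro hu
    have huU : u ∈ PA.biUnion id := by
      rw [hPA.2.2, ← hPB.2.2]
      exact Finset.mem_biUnion.2 ⟨C, hC, hu⟩
    obtain ⟨C', hC', huC'⟩ := Finset.mem_biUnion.1 huU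
    refine ⟨C', ⟨hC', ?_⟩, huC'⟩
    by_contra hne
    exact Finset.disjoint_left.1 (hPB.2.1 _ (hf C' hC').1 C hC hne) ((hf C' hC').2 huC') hu

/-- Calibration: predicted conversions on a coarse cluster split over its refined clusters. -/
theorem IsPartition.sum_weight_mul_clusterPred {α : Type*} [DecidableEq α] {U : Finset α}
    {PA PB : Finset (Finset α)} (hPA : IsPartition U PA) (hPB : IsPartition U PB)
    {f : Finset α → Finset α} (hf : ∀ C' ∈ PA, f C' ∈ PB ∧ C' ⊆ f C')
    (p : α → ℝ) {C : Finset α} (hC : C ∈ PB) :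
    ∑ C' ∈ PA with f C' = C, weight U C' * clusterPred p C' = weight U C * clusterPred p C := by
  simp only [weight_mul_clusterPred]
  rw [← Finset.sum_div]
  congr 1
  conv_rhs => rw [← hPA.biUnion_filter_eq hPB hf hC]
  refine (Finset.sum_biUnion ?_).symm
  intro D hD E hE hne
  exact hPA.2.1 D (Finset.mem_filter.1 hD).1 E (Finset.mem_filter.1 hE).1 hne

/-- Lifting along a refinement preserves the budget usage. -/
theorem IsPartition.sum_lift_eq {α : Type*} [DecidableEq α] {U : Finset α}
    {PA PB : Finset (Finset α)} (hPA : IsPartition U PA) (hPB : IsPartition U PB)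
    {f : Finset α → Finset α} (hf : ∀ C' ∈ PA, f C' ∈ PB ∧ C' ⊆ f C')
    (p : α → ℝ) (x : Finset α → ℝ) (a : ℝ) :
    ∑ C' ∈ PA, weight U C' * x (f C') * a * clusterPred p C'
      = ∑ C ∈ PB, weight U C * x C * a * clusterPred p C := by
  rw [← Finset.sum_fiberwise_of_maps_to (fun C' hC' => (hf C' hC').1)]
  refine Finset.sum_congr rfl fun C hC => ?_
  calc ∑ C' ∈ PA with f C' = C, weight U C' * x (f C') * a * clusterPred p C'
      = ∑ C' ∈ PA with f C' = C, x C * a * (weight U C' * clusterPred p C') := by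
        refine Finset.sum_congr rfl fun C' hC' => ?_
        rw [(Finset.mem_filter.1 hC').2]
        ring
    _ = weight U C * x C * a * clusterPred p C := by
        rw [← Finset.mul_sum, hPA.sum_weight_mul_clusterPred hPB hf p hC]
        ring

theorem lp_lifting_feasible {α ι : Type*} [DecidableEq α] [Fintype ι]
    (U : Finset α) (hU : U.Nonempty)
    (PA PB : Finset (Finset α)) (hPA : IsPartition U PA) (hPB : IsPartition U PB)
    (f : Finset α → Finset α) (hf : ∀ C' ∈ PA, f C' ∈ PB ∧ C' ⊆ f C')
    (a : ι → ℝ) (ha : ∀ i, 0 ≤ a i)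
    (B : ι → ℝ) (hB : ∀ i, 0 ≤ B i)
    (p : ι → α → ℝ) (hp : ∀ i u, p i u ∈ Set.Icc (0 : ℝ) 1)
    (xB : ι → Finset α → ℝ)
    (hx01 : ∀ i, ∀ C ∈ PB, xB i C ∈ Set.Icc (0 : ℝ) 1)
    (hbud : ∀ i, ∑ C ∈ PB, weight U C * xB i C * a i * clusterPred (p i) C ≤ B i)
    (hsup : ∀ C ∈ PB, ∑ i, xB i C ≤ 1) :
    -- x^A_{i,C'} := x^B_{i, f C'} is feasible for the LP over P_A:
    (∀ i, ∀ C' ∈ PA, xB i (f C') ∈ Set.Icc (0 : ℝ) 1) ∧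
    (∀ i, ∑ C' ∈ PA, weight U C' * xB i (f C') * a i * clusterPred (p i) C' ≤ B i) ∧
    (∀ C' ∈ PA, ∑ i, xB i (f C') ≤ 1) ∧
    -- budget usage is preserved exactly:
    (∀ i, ∑ C' ∈ PA, weight U C' * xB i (f C') * a i * clusterPred (p i) C'
        = ∑ C ∈ PB, weight U C * xB i C * a i * clusterPred (p i) C) ∧
    -- the objective values agree:
    (∑ i, ∑ C' ∈ PA, weight U C' * xB i (f C') * a i * clusterPred (p i) C'
        = ∑ i, ∑ C ∈ PB, weight U C * xB i C * a i * clusterPred (p i) C) := by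
  have usage := fun i => hPA.sum_lift_eq hPB hf (p i) (xB i) (a i)
  exact ⟨fun i C' hC' => hx01 i _ (hf C' hC').1, fun i => (usage i).trans_le (hbud i),
    fun C' hC' => hsup _ (hf C' hC').1, usage, Finset.sum_congr rfl fun i _ => usage i⟩
end
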